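/- arXiv:2511.16918 — 3 statements merged into one kernel-verified Lean document; each statement's English description precedes it below -/
import Mathlib

section
/- Let G = (V,E) be a finite simple graph with maximum degree at most Δ, where Δ ≥ 1 is an integer, let 0 < ε < 1 and λ > 0. Then the expected size of a matching drawn from the Gibbs distribution μ_{G,λ} satisfies (Σ_{k≥0} k·m_k(G)·λ^k) / (Σ_{k≥0} m_k(G)·λ^k) ≥ ((1 − ε/2)·λ / (λ + (4Δ)^{2/ε})) · ν(G). -/
open scoped Classical

namespace SensMatching

variable {V : Type*} [Fintype V] [DecidableEq V]

/-- `M` is a matching of `G`: a finset of edges of `G`, no two of which share an endpoint. -/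
def IsMatchingSet (G : SimpleGraph V) (M : Finset (Sym2 V)) : Prop :=
  (∀ e ∈ M, e ∈ G.edgeSet) ∧
    ∀ e ∈ M, ∀ f ∈ M, e ≠ f → ∀ v : V, v ∈ e → v ∉ f

/-- The finset of all matchings of `G`. -/
noncomputable def matchings (G : SimpleGraph V) : Finset (Finset (Sym2 V)) :=
  Finset.univ.filter fun M => IsMatchingSet G M

/-- `ν(G)`: the maximum size of a matching of `G`. -/
noncomputable def nu (G : SimpleGraph V) : ℕ :=
  (matchings G).sup Finset.card

/-- `m_k(G)`: the number of matchings of size `k` in `G`. -/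
noncomputable def numMatchings (G : SimpleGraph V) (k : ℕ) : ℕ :=
  ((matchings G).filter fun M => M.card = k).card

/-- The degree of a vertex `v` in `G`. -/
noncomputable def degr (G : SimpleGraph V) (v : V) : ℕ :=
  (Finset.univ.filter fun w => G.Adj v w).card

/-- The finset of edges of `G`. -/
noncomputable def edges (G : SimpleGraph V) : Finset (Sym2 V) :=
  Finset.univ.filter fun e => e ∈ G.edgeSet

/-- The partition function `Z_G(λ) = Σ_{M matching} λ^{|M|}`. -/
noncomputable def partitionFn (G : SimpleGraph V) (lam : ℝ) : ℝ :=
  ∑ M ∈ matchings G, lam ^ M.card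

/-- The probability, under the Gibbs distribution `μ_{G,λ}`, of the event `p`. -/
noncomputable def gibbsProb (G : SimpleGraph V) (lam : ℝ) (p : Finset (Sym2 V) → Prop) : ℝ :=
  (∑ M ∈ (matchings G).filter p, lam ^ M.card) / partitionFn G lam

/-- The law of `f M`, where `M` follows the Gibbs distribution `μ_{G,λ}` conditioned
on the event `p`. -/
noncomputable def condDistMap (G : SimpleGraph V) (lam : ℝ) (p : Finset (Sym2 V) → Prop)
    (f : Finset (Sym2 V) → Finset (Sym2 V)) (N : Finset (Sym2 V)) : ℝ :=
  (∑ M ∈ ((matchings G).filter p).filter fun M => f M = N, lam ^ M.card) /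
    ∑ M ∈ (matchings G).filter p, lam ^ M.card

/-- The Gibbs distribution `μ_{G,λ}` conditioned on the event `p`. -/
noncomputable def condDist (G : SimpleGraph V) (lam : ℝ) (p : Finset (Sym2 V) → Prop) :
    Finset (Sym2 V) → ℝ :=
  condDistMap G lam p id

/-- The Gibbs distribution `μ_{G,λ}` over matchings of `G`. -/
noncomputable def gibbsDist (G : SimpleGraph V) (lam : ℝ) : Finset (Sym2 V) → ℝ :=
  condDist G lam fun _ => True

/-- `V(M)`: the set of vertices covered by the edge set `M`. -/
noncomputable def coveredVerts (M : Finset (Sym2 V)) : Finset V :=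
  Finset.univ.filter fun v => ∃ e ∈ M, v ∈ e

/-- `N(i)`: the set of edges of `G` sharing an endpoint with `i`, excluding `i` itself. -/
def edgeNbhd (G : SimpleGraph V) (i : Sym2 V) : Set (Sym2 V) :=
  {e | e ∈ G.edgeSet ∧ e ≠ i ∧ ∃ v : V, v ∈ e ∧ v ∈ i}

/-- `π` is a coupling of the distributions `μ` and `μ'`. -/
def IsCoupling {α : Type*} [Fintype α] (π : α × α → ℝ) (μ μ' : α → ℝ) : Prop :=
  (∀ q, 0 ≤ π q) ∧ (∀ a, ∑ b, π (a, b) = μ a) ∧ ∀ b, ∑ a, π (a, b) = μ' b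

/-- The edge-Hamming distance `|M △ M'|`. -/
noncomputable def edist (M M' : Finset (Sym2 V)) : ℕ :=
  ((M \ M') ∪ (M' \ M)).card

/-- The vertex-Hamming distance `|V(M) △ V(M')|`. -/
noncomputable def vdist (M M' : Finset (Sym2 V)) : ℕ :=
  ((coveredVerts M \ coveredVerts M') ∪ (coveredVerts M' \ coveredVerts M)).card

/-- The vertex-Hamming distance ignoring the vertex `u`: `|(V(M) △ V(M')) \ {u}|`. -/
noncomputable def vdistErase (u : V) (M M' : Finset (Sym2 V)) : ℕ :=
  (((coveredVerts M \ coveredVerts M') ∪ (coveredVerts M' \ coveredVerts M)).erase u).card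

/-- `M` satisfies the vertex pinning `(Bp, Bm)`: every vertex of `Bp` is covered by `M`
and no vertex of `Bm` is covered by `M`. -/
def satisfiesPinning (M : Finset (Sym2 V)) (Bp Bm : Finset V) : Prop :=
  (∀ w ∈ Bp, w ∈ coveredVerts M) ∧ ∀ w ∈ Bm, w ∉ coveredVerts M

/-- The Wasserstein distance between `μ` and `μ'` with respect to the metric `d`:
the infimum over couplings of the expected distance. -/
noncomputable def wass {α : Type*} [Fintype α] (d : α → α → ℝ) (μ μ' : α → ℝ) : ℝ :=
  sInf {c : ℝ | ∃ π : α × α → ℝ, IsCoupling π μ μ' ∧ c = ∑ q : α × α, π q * d q.1 q.2}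

open Polynomial

set_option linter.unusedSectionVars false

/-- The matchings of `G` all of whose edges have both endpoints in `S`. -/
noncomputable def matchingsOn (G : SimpleGraph V) (S : Finset V) : Finset (Finset (Sym2 V)) :=
  (matchings G).filter fun M => ∀ e ∈ M, ∀ u ∈ e, u ∈ S

/-- The complex partition function of the matchings of `G` supported on `S`. -/
noncomputable def partitionOn (G : SimpleGraph V) (z : ℂ) (S : Finset V) : ℂ :=
  ∑ M ∈ matchingsOn G S, z ^ M.card

lemma mem_matchings {G : SimpleGraph V} {M : Finset (Sym2 V)} :
    M ∈ matchings G ↔ IsMatchingSet G M := by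
  simp [matchings]

lemma mem_matchingsOn {G : SimpleGraph V} {S : Finset V} {M : Finset (Sym2 V)} :
    M ∈ matchingsOn G S ↔ IsMatchingSet G M ∧ ∀ e ∈ M, ∀ u ∈ e, u ∈ S := by
  simp [matchingsOn, mem_matchings]

lemma matchingsOn_univ (G : SimpleGraph V) : matchingsOn G Finset.univ = matchings G := by
  simp [matchingsOn]

lemma empty_mem_matchings (G : SimpleGraph V) : ∅ ∈ matchings G := by
  simp [mem_matchings, IsMatchingSet]

lemma partitionOn_empty (G : SimpleGraph V) (z : ℂ) : partitionOn G z ∅ = 1 := by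
  have h : matchingsOn G ∅ = {∅} := by
    ext M
    simp only [mem_matchingsOn, Finset.mem_singleton]
    constructor
    · rintro ⟨-, h⟩
      refine Finset.eq_empty_of_forall_notMem fun e he => ?_
      induction e using Sym2.ind with
      | h a b => simpa using h _ he a (Sym2.mem_mk_left a b)
    · rintro rfl
      simp [IsMatchingSet]
  simp [partitionOn, h]

lemma notMem_of_mem_matchingsOn {G : SimpleGraph V} {S : Finset V} {M : Finset (Sym2 V)}
    (hM : M ∈ matchingsOn G S) {v : V} (hv : v ∉ S) {e : Sym2 V} (he : v ∈ e) : e ∉ M :=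
  fun h => hv ((mem_matchingsOn.1 hM).2 e h v he)

lemma insert_mem_matchingsOn {G : SimpleGraph V} {S : Finset V} {v w : V} (hv : v ∈ S)
    (hw : w ∈ S) (hvw : G.Adj v w) {M : Finset (Sym2 V)}
    (hM : M ∈ matchingsOn G ((S.erase v).erase w)) : insert s(v, w) M ∈ matchingsOn G S := by
  obtain ⟨⟨hE, hD⟩, hS⟩ := mem_matchingsOn.1 hM
  have key : ∀ e ∈ M, ∀ u ∈ e, u ≠ w ∧ u ≠ v ∧ u ∈ S := by simpa using hS
  refine mem_matchingsOn.2 ⟨⟨?_, ?_⟩, ?_⟩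
  · intro e he
    rcases Finset.mem_insert.1 he with rfl | he
    · exact hvw
    · exact hE e he
  · intro e he f hf hef u hue huf
    rcases Finset.mem_insert.1 he with rfl | he <;> rcases Finset.mem_insert.1 hf with rfl | hf
    · exact hef rfl
    · have := key f hf u huf
      rcases Sym2.mem_iff.1 hue with rfl | rfl <;> simp at this
    · have := key e he u hue
      rcases Sym2.mem_iff.1 huf with rfl | rfl <;> simp at this
    · exact hD e he f hf hef u hue huf
  · intro e he u hu
    rcases Finset.mem_insert.1 he with rfl | he
    · rcases Sym2.mem_iff.1 hu with rfl | rfl <;> assumption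
    · exact (key e he u hu).2.2

lemma erase_mem_matchingsOn {G : SimpleGraph V} {S : Finset V} {v w : V}
    {M : Finset (Sym2 V)} (hM : M ∈ matchingsOn G S) (h : s(v, w) ∈ M) :
    M.erase s(v, w) ∈ matchingsOn G ((S.erase v).erase w) := by
  obtain ⟨⟨hE, hD⟩, hS⟩ := mem_matchingsOn.1 hM
  refine mem_matchingsOn.2 ⟨⟨fun e he => hE e (Finset.mem_of_mem_erase he),
    fun e he f hf => hD e (Finset.mem_of_mem_erase he) f (Finset.mem_of_mem_erase hf)⟩, ?_⟩
  intro e he u hu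
  have hu' := hD e (Finset.mem_of_mem_erase he) _ h (Finset.ne_of_mem_erase he) u hu
  simp only [Sym2.mem_iff, not_or] at hu'
  simp [hu'.1, hu'.2, hS e (Finset.mem_of_mem_erase he) u hu]

lemma matchingsOn_eq_union (G : SimpleGraph V) {S : Finset V} {v : V} (hv : v ∈ S) :
    matchingsOn G S = matchingsOn G (S.erase v) ∪
      ((S.erase v).filter fun w => G.Adj v w).biUnion fun w =>
        (matchingsOn G ((S.erase v).erase w)).image (insert s(v, w)) := by
  ext M
  simp only [Finset.mem_union, Finset.mem_biUnion, Finset.mem_image, Finset.mem_filter]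
  constructor
  · intro hM
    obtain ⟨⟨hE, hD⟩, hS⟩ := mem_matchingsOn.1 hM
    by_cases h : ∃ e ∈ M, v ∈ e
    · obtain ⟨e, he, w, rfl⟩ := h
      have hvw : G.Adj v w := hE _ he
      exact Or.inr ⟨w, ⟨Finset.mem_erase.2 ⟨hvw.ne', hS _ he w (Sym2.mem_mk_right v w)⟩, hvw⟩,
        _, erase_mem_matchingsOn hM he, Finset.insert_erase he⟩
    · push Not at h
      refine Or.inl (mem_matchingsOn.2 ⟨⟨hE, hD⟩, fun e he u hu => Finset.mem_erase.2
        ⟨?_, hS e he u hu⟩⟩)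
      rintro rfl
      exact h e he hu
  · rintro (hM | ⟨w, ⟨hw, hvw⟩, M, hM, rfl⟩)
    · obtain ⟨h, hS⟩ := mem_matchingsOn.1 hM
      exact mem_matchingsOn.2 ⟨h, fun e he u hu => Finset.mem_of_mem_erase (hS e he u hu)⟩
    · exact insert_mem_matchingsOn hv (Finset.mem_of_mem_erase hw) hvw hM

/-- The vertex-deletion recurrence for the partition function. -/
lemma partitionOn_eq (G : SimpleGraph V) (z : ℂ) {S : Finset V} {v : V} (hv : v ∈ S) :
    partitionOn G z S = partitionOn G z (S.erase v) +
      ∑ w ∈ (S.erase v).filter fun w => G.Adj v w,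
        z * partitionOn G z ((S.erase v).erase w) := by
  have hnot : ∀ w, ∀ M ∈ matchingsOn G ((S.erase v).erase w), ∀ u, s(v, u) ∉ M :=
    fun w M hM u => notMem_of_mem_matchingsOn hM (by simp) (Sym2.mem_mk_left v u)
  have hdisj : Disjoint (matchingsOn G (S.erase v))
      (((S.erase v).filter fun w => G.Adj v w).biUnion fun w =>
        (matchingsOn G ((S.erase v).erase w)).image (insert s(v, w))) := by
    refine Finset.disjoint_left.2 fun M hM hM' => ?_
    simp only [Finset.mem_biUnion, Finset.mem_image] at hM'
    obtain ⟨w, -, M, -, rfl⟩ := hM'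
    exact notMem_of_mem_matchingsOn hM (Finset.notMem_erase v S) (Sym2.mem_mk_left v w)
      (Finset.mem_insert_self _ _)
  have hpair : Set.PairwiseDisjoint
      (((S.erase v).filter fun w => G.Adj v w : Finset V) : Set V) fun w =>
        (matchingsOn G ((S.erase v).erase w)).image (insert s(v, w)) := by
    intro w _ w' _ hne
    refine Finset.disjoint_left.2 fun M hM hM' => ?_
    obtain ⟨N, hN, rfl⟩ := Finset.mem_image.1 hM
    obtain ⟨N', hN', h⟩ := Finset.mem_image.1 hM'
    have h1 : s(v, w') ∈ insert s(v, w) N := h ▸ Finset.mem_insert_self _ _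
    rcases Finset.mem_insert.1 h1 with h1 | h1
    · exact hne (Sym2.congr_right.1 h1).symm
    · exact hnot w N hN w' h1
  rw [partitionOn, matchingsOn_eq_union G hv, Finset.sum_union hdisj, Finset.sum_biUnion hpair,
    partitionOn]
  congr 1
  refine Finset.sum_congr rfl fun w _ => ?_
  rw [Finset.sum_image, partitionOn, Finset.mul_sum]
  · refine Finset.sum_congr rfl fun M hM => ?_
    rw [Finset.card_insert_of_notMem (hnot w M hM w), pow_succ']
  · intro M hM N hN h
    rw [← Finset.erase_insert (hnot w M hM w), ← Finset.erase_insert (hnot w N hN w), h]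

/-- The partition function has no zero at `s ^ 2` when `s` lies in the open right half-plane,
since its ratios, divided by `s`, stay in that half-plane. -/
lemma partitionOn_ne_zero (G : SimpleGraph V) {s : ℂ} (hs : 0 < s.re) (S : Finset V) :
    partitionOn G (s ^ 2) S ≠ 0 ∧
      ∀ v ∈ S, 0 < (partitionOn G (s ^ 2) S / partitionOn G (s ^ 2) (S.erase v) / s).re := by
  have inv_re_pos : ∀ z : ℂ, 0 < z.re → 0 < (z⁻¹).re := fun z hz => by
    rw [Complex.inv_re]
    have : z ≠ 0 := by rintro rfl; simp at hz
    exact div_pos hz (Complex.normSq_pos.2 this)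
  have hs0 : s ≠ 0 := by rintro rfl; simp at hs
  induction S using Finset.strongInduction with
  | H S ih =>
    have ratio : ∀ v ∈ S,
        0 < (partitionOn G (s ^ 2) S / partitionOn G (s ^ 2) (S.erase v) / s).re := by
      intro v hv
      obtain ⟨h0, hr⟩ := ih _ (Finset.erase_ssubset hv)
      have heq : partitionOn G (s ^ 2) S / partitionOn G (s ^ 2) (S.erase v) / s =
          s⁻¹ + ∑ w ∈ (S.erase v).filter fun w => G.Adj v w,
            (partitionOn G (s ^ 2) (S.erase v) /
              partitionOn G (s ^ 2) ((S.erase v).erase w) / s)⁻¹ := by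
        rw [partitionOn_eq G _ hv, add_div, add_div, div_self h0, one_div, Finset.sum_div,
          Finset.sum_div]
        congr 1
        refine Finset.sum_congr rfl fun w _ => ?_
        rw [inv_div, div_div_eq_mul_div]
        field_simp
      rw [heq, Complex.add_re, Complex.re_sum]
      exact add_pos_of_pos_of_nonneg (inv_re_pos s hs) (Finset.sum_nonneg fun w hw =>
        (inv_re_pos _ (hr w (Finset.mem_filter.1 hw).1)).le)
    refine ⟨?_, ratio⟩
    rcases S.eq_empty_or_nonempty with rfl | ⟨v, hv⟩
    · simp [partitionOn_empty]
    · intro h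
      simpa [h] using ratio v hv

/-- The generating polynomial of the matchings of `G`. -/
noncomputable def matchingPoly (G : SimpleGraph V) : ℝ[X] :=
  ∑ M ∈ matchings G, X ^ M.card

lemma matchingPoly_coeff (G : SimpleGraph V) (k : ℕ) :
    (matchingPoly G).coeff k = numMatchings G k := by
  simp [matchingPoly, coeff_X_pow, numMatchings, eq_comm]

lemma numMatchings_zero (G : SimpleGraph V) : numMatchings G 0 = 1 := by
  rw [numMatchings, Finset.card_eq_one]
  refine ⟨∅, ?_⟩
  ext M
  simp only [Finset.mem_filter, Finset.card_eq_zero, Finset.mem_singleton, and_iff_right_iff_imp]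
  rintro rfl
  exact empty_mem_matchings G

lemma exists_card_eq_nu (G : SimpleGraph V) : ∃ M ∈ matchings G, M.card = nu G := by
  obtain ⟨M, hM, h⟩ := Finset.exists_mem_eq_sup (matchings G) ⟨∅, empty_mem_matchings G⟩
    Finset.card
  exact ⟨M, hM, h.symm⟩

lemma card_le_nu {G : SimpleGraph V} {M : Finset (Sym2 V)} (hM : M ∈ matchings G) :
    M.card ≤ nu G :=
  Finset.le_sup (f := Finset.card) hM

lemma one_le_numMatchings_nu (G : SimpleGraph V) : 1 ≤ numMatchings G (nu G) := by
  obtain ⟨M, hM, h⟩ := exists_card_eq_nu G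
  exact Finset.card_pos.2 ⟨M, Finset.mem_filter.2 ⟨hM, h⟩⟩

lemma matchingPoly_natDegree (G : SimpleGraph V) : (matchingPoly G).natDegree = nu G := by
  refine natDegree_eq_of_le_of_coeff_ne_zero ?_ ?_
  · exact natDegree_sum_le_of_forall_le _ _ fun M hM => by
      simpa using card_le_nu hM
  · rw [matchingPoly_coeff]
    have := one_le_numMatchings_nu G
    positivity

lemma sum_numMatchings (G : SimpleGraph V) (f : ℕ → ℝ) :
    ∑ k ∈ Finset.range (nu G + 1), (numMatchings G k : ℝ) * f k =
      ∑ M ∈ matchings G, f M.card := by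
  rw [← Finset.sum_fiberwise_of_maps_to (s := matchings G) (t := Finset.range (nu G + 1))
    (g := Finset.card) fun M hM => Finset.mem_range_succ_iff.2 (card_le_nu hM)]
  refine Finset.sum_congr rfl fun k _ => ?_
  rw [Finset.sum_congr rfl fun M hM => by rw [(Finset.mem_filter.1 hM).2], Finset.sum_const,
    nsmul_eq_mul, numMatchings]

/-- The real-rootedness theorem of Heilmann and Lieb. -/
lemma im_eq_zero_and_re_nonpos_of_isRoot (G : SimpleGraph V) {z : ℂ}
    (hz : ((matchingPoly G).map Complex.ofRealHom).IsRoot z) : z.im = 0 ∧ z.re ≤ 0 := by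
  have hz' : partitionOn G z Finset.univ = 0 := by
    have : ((matchingPoly G).map Complex.ofRealHom).eval z = partitionOn G z Finset.univ := by
      simp [matchingPoly, partitionOn, matchingsOn_univ, eval_finsetSum, Polynomial.map_sum]
    rw [← this]
    exact hz
  obtain ⟨s, rfl⟩ := IsAlgClosed.exists_pow_nat_eq z (n := 2) two_pos
  have hs : s.re = 0 := by
    rcases lt_trichotomy s.re 0 with h | h | h
    · refine absurd ?_ (partitionOn_ne_zero G (s := -s) (by simpa using h) Finset.univ).1
      simpa using hz'
    · exact h
    · exact absurd hz' (partitionOn_ne_zero G h Finset.univ).1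
  constructor
  · simp [sq, hs]
  · simp [sq, hs, mul_self_nonneg]

lemma matchingPoly_splits (G : SimpleGraph V) : (matchingPoly G).Splits := by
  refine Splits.of_splits_map Complex.ofRealHom (IsAlgClosed.splits _) fun z hz => ?_
  have h := (im_eq_zero_and_re_nonpos_of_isRoot G (isRoot_of_mem_roots hz)).1
  exact ⟨z.re, Complex.ext (by simp) (by simp [h])⟩

lemma neg_of_mem_roots_matchingPoly (G : SimpleGraph V) {x : ℝ}
    (hx : x ∈ (matchingPoly G).roots) : x < 0 := by
  have hr := isRoot_of_mem_roots hx
  have h : x ≤ 0 := by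
    simpa using (im_eq_zero_and_re_nonpos_of_isRoot G (hr.map (f := Complex.ofRealHom))).2
  refine lt_of_le_of_ne h ?_
  rintro rfl
  have h0 := matchingPoly_coeff G 0
  rw [coeff_zero_eq_eval_zero, hr.eq_zero, numMatchings_zero] at h0
  norm_num at h0

lemma card_coveredVerts_le (M : Finset (Sym2 V)) : (coveredVerts M).card ≤ 2 * M.card := by
  have h : coveredVerts M ⊆ M.biUnion fun e => e.toFinset := by
    intro v hv
    simpa [coveredVerts] using hv
  refine (Finset.card_le_card h).trans ?_
  rw [mul_comm]
  exact Finset.card_biUnion_le_card_mul _ _ _ fun e _ => by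
    rw [Sym2.card_toFinset]
    split_ifs <;> simp

/-- The vertices of a maximum matching form a vertex cover, which bounds the number of edges. -/
lemma numMatchings_one_le (G : SimpleGraph V) {Δ : ℕ} (hdeg : ∀ v : V, degr G v ≤ Δ) :
    numMatchings G 1 ≤ 2 * nu G * Δ := by
  obtain ⟨M, hM, hcard⟩ := exists_card_eq_nu G
  obtain ⟨hE, hD⟩ := mem_matchings.1 hM
  have hsub : ((matchings G).filter fun N => N.card = 1) ⊆
      (coveredVerts M).biUnion fun v =>
        (Finset.univ.filter fun w => G.Adj v w).image fun w => {s(v, w)} := by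
    intro N hN
    obtain ⟨hN, h1⟩ := Finset.mem_filter.1 hN
    obtain ⟨e, rfl⟩ := Finset.card_eq_one.1 h1
    have he : e ∈ G.edgeSet := (mem_matchings.1 hN).1 e (Finset.mem_singleton_self e)
    have hcov : ∃ v ∈ e, v ∈ coveredVerts M := by
      by_contra! hcon
      have hfree : ∀ v ∈ e, ∀ f ∈ M, v ∉ f := fun v hv f hf hvf =>
        hcon v hv (by simpa [coveredVerts] using ⟨f, hf, hvf⟩)
      have heM : e ∉ M := by
        induction e using Sym2.ind with
        | h a b => exact fun h => hfree a (Sym2.mem_mk_left a b) _ h (Sym2.mem_mk_left a b)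
      have hins : insert e M ∈ matchings G := by
        refine mem_matchings.2 ⟨?_, ?_⟩
        · intro f hf
          rcases Finset.mem_insert.1 hf with rfl | hf
          · exact he
          · exact hE f hf
        · intro f hf g hg hfg v hvf hvg
          rcases Finset.mem_insert.1 hf with rfl | hfM <;>
            rcases Finset.mem_insert.1 hg with rfl | hgM
          · exact hfg rfl
          · exact hfree v hvf g hgM hvg
          · exact hfree v hvg f hfM hvf
          · exact hD f hfM g hgM hfg v hvf hvg
      have := card_le_nu hins
      rw [Finset.card_insert_of_notMem heM] at this
      omega
    obtain ⟨v, ⟨w, rfl⟩, hv⟩ := hcov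
    simp only [Finset.mem_biUnion, Finset.mem_image, Finset.mem_filter, Finset.mem_univ, true_and]
    exact ⟨v, hv, w, he, rfl⟩
  calc numMatchings G 1 ≤ _ := Finset.card_le_card hsub
    _ ≤ (coveredVerts M).card * Δ := Finset.card_biUnion_le_card_mul _ _ _ fun v _ =>
        Finset.card_image_le.trans (hdeg v)
    _ ≤ 2 * nu G * Δ := Nat.mul_le_mul_right _ (hcard ▸ card_coveredVerts_le M)

lemma log_multiset_prod (m : Multiset ℝ) (h : ∀ x ∈ m, x ≠ 0) :
    Real.log m.prod = (m.map Real.log).sum := by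
  induction m using Multiset.induction with
  | empty => simp
  | cons a m ih =>
    have hm : ∀ x ∈ m, x ≠ 0 := fun x hx => h x (Multiset.mem_cons_of_mem hx)
    rw [Multiset.prod_cons, Real.log_mul (h a (Multiset.mem_cons_self a m))
      (Multiset.prod_ne_zero fun h0 => hm 0 h0 rfl), ih hm, Multiset.map_cons, Multiset.sum_cons]

/-- A root `-y` far from the origin is penalised by `log y`, and one near it by `y⁻¹`. -/
lemma div_add_ge {y lam L C D : ℝ} (hy : 0 < y) (hlam : 0 < lam) (hD : 0 < D)
    (hL : L = Real.log D) (hC : 0 < C) (hK : 0 < Real.log C - 1 + L) :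
    lam / (lam + C) * (1 - (Real.log y + y⁻¹ / D - 1 + L) / (Real.log C - 1 + L)) ≤
      lam / (lam + y) := by
  have hlog : 0 ≤ Real.log y + y⁻¹ / D - 1 + L := by
    have h := Real.log_le_sub_one_of_pos (x := y⁻¹ / D) (by positivity)
    rw [Real.log_div (by positivity) hD.ne', Real.log_inv] at h
    linarith
  rcases le_or_gt y C with h | h
  · calc _ ≤ lam / (lam + C) * 1 := by
          gcongr
          linarith [div_nonneg hlog hK.le]
      _ ≤ _ := by rw [mul_one]; gcongr
  · refine le_trans ?_ (by positivity : (0 : ℝ) ≤ lam / (lam + y))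
    refine mul_nonpos_of_nonneg_of_nonpos (by positivity) ?_
    rw [sub_nonpos, one_le_div hK]
    have := Real.log_le_log hC h.le
    have : 0 < y⁻¹ / D := by positivity
    linarith

lemma logDeriv_lower_bound {P : ℝ[X]} (hP : P.Splits) (hneg : ∀ x ∈ P.roots, x < 0)
    (h0 : P.coeff 0 = 1) (hlead : 1 ≤ P.leadingCoeff) {D : ℝ} (hD : 2 ≤ D)
    (h1 : P.coeff 1 ≤ D * P.natDegree) {δ lam : ℝ} (hδ0 : 0 < δ) (hδ1 : δ < 1 / 2)
    (hlam : 0 < lam) :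
    (1 - δ) * lam / (lam + (2 * D) ^ (1 / δ)) * P.natDegree ≤
      lam * P.derivative.eval lam / P.eval lam := by
  have hD0 : 0 < D := by linarith
  set C : ℝ := (2 * D) ^ (1 / δ) with hCdef
  have hC : 0 < C := by positivity
  set L := Real.log D with hL
  have hlog2 := Real.log_two_gt_d9
  have hLge : Real.log 2 ≤ L := Real.log_le_log two_pos hD
  have hlogC : δ * Real.log C = Real.log 2 + L := by
    rw [hCdef, Real.log_rpow (by positivity), Real.log_mul two_ne_zero hD0.ne', ← hL]
    field_simp
  set K := Real.log C - 1 + L with hKdef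
  have hLK : L ≤ δ * K := by
    have : δ * K = Real.log 2 + L + δ * (L - 1) := by rw [← hlogC, hKdef]; ring
    nlinarith
  have hK : 0 < K := by
    by_contra! hcon
    nlinarith
  have hP0 : P ≠ 0 := by rintro rfl; simp at h0
  have heval : P.eval lam ≠ 0 := fun h => by
    linarith [hneg lam ((mem_roots hP0).2 h)]
  have heval0 : P.eval 0 = 1 := by rw [← coeff_zero_eq_eval_zero, h0]
  rw [mul_div_assoc lam, hP.eval_derivative_div_eval_of_ne_zero heval,
    ← Multiset.sum_map_mul_left]
  have hinv : (P.roots.map fun x => 1 / (0 - x)).sum = P.coeff 1 := by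
    have h := hP.eval_derivative_eq_eval_mul_sum (x := 0) (by rw [heval0]; exact one_ne_zero)
    rw [heval0, one_mul] at h
    rw [← h, ← coeff_zero_eq_eval_zero, coeff_derivative]
    simp
  have hlogsum : (P.roots.map Real.log).sum ≤ 0 := by
    rw [← log_multiset_prod _ fun x hx => (hneg x hx).ne]
    have h := congrArg abs (hP.coeff_zero_eq_leadingCoeff_mul_prod_roots)
    rw [h0, abs_mul, abs_mul, abs_pow, abs_neg, abs_one, one_pow, one_mul,
      abs_of_pos (by linarith)] at h
    rw [← Real.log_abs]
    refine Real.log_nonpos (abs_nonneg _) ?_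
    nlinarith [abs_nonneg P.roots.prod]
  have hcard : (P.roots.card : ℝ) = P.natDegree := by rw [hP.natDegree_eq_card_roots]
  have hsum : (P.roots.map fun x => lam / (lam + C) *
      (1 - (Real.log x + 1 / (0 - x) / D - 1 + L) / K)).sum =
      lam / (lam + C) * (P.natDegree - ((P.roots.map Real.log).sum +
        P.coeff 1 / D - P.natDegree + P.natDegree * L) / K) := by
    rw [← hinv, ← hcard]
    simp only [Multiset.sum_map_mul_left, Multiset.sum_map_sub, Multiset.sum_map_add,
      Multiset.sum_map_div, Multiset.map_const', Multiset.sum_replicate, nsmul_eq_mul, mul_one]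
  calc _ = lam / (lam + C) * ((1 - δ) * P.natDegree) := by ring
    _ ≤ _ := by
      rw [mul_comm (1 - δ)]
      refine mul_le_mul_of_nonneg_left ?_ (by positivity)
      have hn : (0 : ℝ) ≤ P.natDegree := by positivity
      have hle : P.coeff 1 / D ≤ P.natDegree := by
        rw [div_le_iff₀ hD0]; linarith
      have : ((P.roots.map Real.log).sum + P.coeff 1 / D - P.natDegree + P.natDegree * L) / K
          ≤ P.natDegree * δ := by
        rw [div_le_iff₀ hK]
        nlinarith
      linarith
    _ = _ := hsum.symm
    _ ≤ _ := by
      refine Multiset.sum_map_le_sum_map _ _ fun x hx => ?_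
      have h := div_add_ge (y := -x) (by linarith [hneg x hx]) hlam hD0 hL hC hK
      simpa [hKdef, sub_eq_add_neg, div_eq_mul_inv] using h

/-- the expected matching size under the Gibbs distribution `μ_{G,λ}` on a
graph of maximum degree at most `Δ` is at least
`((1 − ε/2)·λ / (λ + (4Δ)^{2/ε})) · ν(G)`. -/
theorem stmt_0 {V : Type*} [Fintype V] [DecidableEq V]
    (G : SimpleGraph V) (Δ : ℕ) (hΔ : 1 ≤ Δ) (hdeg : ∀ v : V, degr G v ≤ Δ)
    (ε lam : ℝ) (hε0 : 0 < ε) (hε1 : ε < 1) (hlam : 0 < lam) :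
    (1 - ε / 2) * lam / (lam + (4 * (Δ : ℝ)) ^ ((2 : ℝ) / ε)) * (nu G : ℝ) ≤
      (∑ k ∈ Finset.range (nu G + 1), (k : ℝ) * (numMatchings G k : ℝ) * lam ^ k) /
        ∑ k ∈ Finset.range (nu G + 1), (numMatchings G k : ℝ) * lam ^ k := by
  have hnum : ∑ k ∈ Finset.range (nu G + 1), (k : ℝ) * (numMatchings G k : ℝ) * lam ^ k =
      lam * (matchingPoly G).derivative.eval lam := by
    rw [Finset.sum_congr rfl fun (k : ℕ) _ => show (k : ℝ) * (numMatchings G k : ℝ) * lam ^ k =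
      numMatchings G k * ((k : ℝ) * lam ^ k) by ring, sum_numMatchings G fun k => (k : ℝ) * lam ^ k]
    simp only [matchingPoly, derivative_sum, eval_finsetSum, derivative_X_pow, eval_mul, eval_C,
      eval_pow, eval_X, Finset.mul_sum]
    refine Finset.sum_congr rfl fun M _ => ?_
    rcases M.card with _ | n
    · simp
    · simp only [Nat.add_sub_cancel]
      ring
  have hden : ∑ k ∈ Finset.range (nu G + 1), (numMatchings G k : ℝ) * lam ^ k =
      (matchingPoly G).eval lam := by
    rw [sum_numMatchings G fun k => lam ^ k]
    simp [matchingPoly, eval_finsetSum]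
  rw [hnum, hden, ← matchingPoly_natDegree, show 4 * (Δ : ℝ) = 2 * (2 * Δ) by ring,
    show (2 : ℝ) / ε = 1 / (ε / 2) by field_simp]
  refine logDeriv_lower_bound (matchingPoly_splits G)
    (fun x hx => neg_of_mem_roots_matchingPoly G hx) ?_ ?_ ?_ ?_ (by linarith) (by linarith) hlam
  · rw [matchingPoly_coeff, numMatchings_zero, Nat.cast_one]
  · rw [leadingCoeff, matchingPoly_natDegree, matchingPoly_coeff]
    exact_mod_cast one_le_numMatchings_nu G
  · have : (1 : ℝ) ≤ Δ := by exact_mod_cast hΔ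
    linarith
  · rw [matchingPoly_coeff, matchingPoly_natDegree]
    have : (numMatchings G 1 : ℝ) ≤ 2 * nu G * Δ := by exact_mod_cast numMatchings_one_le G hdeg
    linarith

end SensMatching
end

section
/- Let G = (V,E) be a finite simple graph, let v ∈ V be a vertex of degree d, and let λ > 0. Then the probability under the Gibbs distribution μ_{G,λ} that v is covered by the random matching M (i.e., that some edge of M is incident to v) is at most λd/(1 + λd). -/
open scoped Classical

namespace SensMatching

variable {V : Type*} [Fintype V] [DecidableEq V]

/-- The edge set `M` covers the vertex `v`. -/
def Covers {V : Type*} (v : V) (M : Finset (Sym2 V)) : Prop :=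
  ∃ e ∈ M, v ∈ e

/-- Removing the edge at `v` from a matching that covers `v` leaves a matching that does not. -/
theorem exists_insert_of_covered {W : Type*} [DecidableEq W] {G : SimpleGraph W}
    {v : W} {M : Finset (Sym2 W)}
    (hM : IsMatchingSet G M) (hv : Covers v M) :
    ∃ w, G.Adj v w ∧ ∃ N, IsMatchingSet G N ∧ ¬ Covers v N ∧ insert s(v, w) N = M := by
  obtain ⟨e, he, hve⟩ := hv
  obtain ⟨w, rfl⟩ := hve
  refine ⟨w, hM.1 _ he, M.erase s(v, w), ⟨fun e h => hM.1 e (Finset.mem_of_mem_erase h),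
    fun e h f h' => hM.2 e (Finset.mem_of_mem_erase h) f (Finset.mem_of_mem_erase h')⟩, ?_,
    Finset.insert_erase he⟩
  rintro ⟨f, hf, hvf⟩
  exact hM.2 f (Finset.mem_of_mem_erase hf) _ he (Finset.ne_of_mem_erase hf) v hvf
    (Sym2.mem_mk_left v w)

/-- The weight of the matchings covering `v` is at most `λd` times the weight of those
that do not. -/
theorem sum_covered_le (G : SimpleGraph V) (v : V) {lam : ℝ} (hlam : 0 ≤ lam) :
    ∑ M ∈ (matchings G).filter (Covers v), lam ^ M.card ≤
      lam * (degr G v : ℝ) *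
        ∑ M ∈ (matchings G).filter (fun M => ¬ Covers v M), lam ^ M.card := by
  set U := (matchings G).filter (fun M => ¬ Covers v M) with hU
  set N := Finset.univ.filter (fun w => G.Adj v w) with hN
  calc _ ≤ ∑ M ∈ (N ×ˢ U).image (fun p => insert s(v, p.1) p.2), lam ^ M.card := by
        refine Finset.sum_le_sum_of_subset_of_nonneg (fun M hM => ?_)
          fun _ _ _ => pow_nonneg hlam _
        simp only [matchings, Finset.mem_filter, Finset.mem_univ, true_and] at hM
        obtain ⟨w, hw, M', hM', hv, rfl⟩ := exists_insert_of_covered hM.1 hM.2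
        refine Finset.mem_image.2 ⟨(w, M'), ?_, rfl⟩
        simp only [hU, hN, matchings, Finset.mem_product, Finset.mem_filter, Finset.mem_univ,
          true_and]
        exact ⟨hw, hM', hv⟩
    _ ≤ ∑ p ∈ N ×ˢ U, lam ^ (insert s(v, p.1) p.2).card :=
        Finset.sum_image_le_of_nonneg fun _ _ => pow_nonneg hlam _
    _ = ∑ p ∈ N ×ˢ U, lam * lam ^ p.2.card := by
        refine Finset.sum_congr rfl fun p hp => ?_
        have hv := (Finset.mem_filter.1 (Finset.mem_product.1 hp).2).2
        rw [Finset.card_insert_of_notMem fun h => hv ⟨_, h, Sym2.mem_mk_left v p.1⟩, pow_succ']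
    _ = _ := by
        simp only [Finset.sum_product, Finset.sum_const, nsmul_eq_mul, ← Finset.mul_sum, degr, hN]
        ring

/-- under the Gibbs distribution `μ_{G,λ}`, the probability that a vertex
`v` of degree `d` is covered by the random matching is at most `λd/(1 + λd)`. -/
theorem stmt_5 {V : Type*} [Fintype V] [DecidableEq V]
    (G : SimpleGraph V) (v : V) (lam : ℝ) (hlam : 0 < lam) :
    gibbsProb G lam (fun M => ∃ e ∈ M, v ∈ e) ≤
      lam * (degr G v : ℝ) / (1 + lam * (degr G v : ℝ)) := by
  change gibbsProb G lam (Covers v) ≤ _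
  have hC := sum_covered_le G v hlam.le
  have hZ := Finset.sum_filter_add_sum_filter_not (matchings G) (Covers v)
    fun M => lam ^ M.card
  have hpos : 0 < partitionFn G lam :=
    Finset.sum_pos (fun M _ => pow_pos hlam _) ⟨∅, Finset.mem_filter.2 (by simp [IsMatchingSet])⟩
  rw [gibbsProb, div_le_div_iff₀ hpos (by positivity), partitionFn, ← hZ]
  linarith

end SensMatching
end

section
/- Let G = (V,E) be a finite simple graph with maximum degree at most Δ (Δ ≥ 1), let i ∈ E, and let λ > 0. Then there exists a coupling π of the two conditional distributions μ_{G,λ}(· | i ∈ M) and μ_{G,λ}(· | i ∉ M) such that E_{(M,M') ∼ π}[|M △ M'|] ≤ 1 + 2λΔ. -/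
open scoped Classical

namespace SensMatching

variable {V : Type*} [Fintype V] [DecidableEq V]

section Transport

variable {α : Type*} [Fintype α]

/-- `μ` can be transported to `ν` with expected distance at most `c`. -/
def TransportLE (d : α → α → ℝ) (μ ν : α → ℝ) (c : ℝ) : Prop :=
  ∃ π : α × α → ℝ, IsCoupling π μ ν ∧ ∑ q : α × α, π q * d q.1 q.2 ≤ c

/-- The pushforward of the weight function `μ` along `f`. -/
noncomputable def push (f : α → α) (μ : α → ℝ) (b : α) : ℝ :=
  ∑ a, if f a = b then μ a else 0

theorem TransportLE.mono {d : α → α → ℝ} {μ ν : α → ℝ} {c c' : ℝ}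
    (h : TransportLE d μ ν c) (hc : c ≤ c') : TransportLE d μ ν c' := by
  obtain ⟨π, hπ, hcost⟩ := h
  exact ⟨π, hπ, hcost.trans hc⟩

theorem TransportLE.symm {d : α → α → ℝ} (hd : ∀ a b, d a b = d b a) {μ ν : α → ℝ} {c : ℝ}
    (h : TransportLE d μ ν c) : TransportLE d ν μ c := by
  obtain ⟨π, ⟨h0, h1, h2⟩, hcost⟩ := h
  refine ⟨fun q => π q.swap, ⟨fun q => h0 _, h2, h1⟩, le_trans (le_of_eq ?_) hcost⟩
  refine Fintype.sum_equiv (Equiv.prodComm α α) _ _ fun q => ?_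
  simp [hd q.1 q.2]

theorem TransportLE.smul {d : α → α → ℝ} {μ ν : α → ℝ} {c t : ℝ} (ht : 0 ≤ t)
    (h : TransportLE d μ ν c) :
    TransportLE d (fun a => t * μ a) (fun a => t * ν a) (t * c) := by
  obtain ⟨π, ⟨h0, h1, h2⟩, hcost⟩ := h
  refine ⟨fun q => t * π q, ⟨fun q => mul_nonneg ht (h0 q), fun a => ?_, fun b => ?_⟩, ?_⟩
  · simp only [← Finset.mul_sum, h1]
  · simp only [← Finset.mul_sum, h2]
  · simp only [mul_assoc, ← Finset.mul_sum]
    gcongr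

theorem TransportLE.add {d : α → α → ℝ} {μ ν μ' ν' : α → ℝ} {c c' : ℝ}
    (h : TransportLE d μ ν c) (h' : TransportLE d μ' ν' c') :
    TransportLE d (fun a => μ a + μ' a) (fun a => ν a + ν' a) (c + c') := by
  obtain ⟨π, ⟨h0, h1, h2⟩, hcost⟩ := h
  obtain ⟨π', ⟨h0', h1', h2'⟩, hcost'⟩ := h'
  refine ⟨fun q => π q + π' q, ⟨fun q => add_nonneg (h0 q) (h0' q), fun a => ?_, fun b => ?_⟩, ?_⟩
  · simp only [Finset.sum_add_distrib, h1, h1']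
  · simp only [Finset.sum_add_distrib, h2, h2']
  · simp only [add_mul, Finset.sum_add_distrib]
    exact add_le_add hcost hcost'

theorem TransportLE.sum {ι : Type*} {d : α → α → ℝ} (s : Finset ι) {μ ν : ι → α → ℝ} {c : ι → ℝ}
    (h : ∀ k ∈ s, TransportLE d (μ k) (ν k) (c k)) :
    TransportLE d (fun a => ∑ k ∈ s, μ k a) (fun a => ∑ k ∈ s, ν k a) (∑ k ∈ s, c k) := by
  choose! π hπ using h
  refine ⟨fun q => ∑ k ∈ s, π k q,
    ⟨fun q => Finset.sum_nonneg fun k hk => (hπ k hk).1.1 q, fun a => ?_, fun b => ?_⟩, ?_⟩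
  · rw [Finset.sum_comm]
    exact Finset.sum_congr rfl fun k hk => (hπ k hk).1.2.1 a
  · rw [Finset.sum_comm]
    exact Finset.sum_congr rfl fun k hk => (hπ k hk).1.2.2 b
  · simp only [Finset.sum_mul]
    rw [Finset.sum_comm]
    exact Finset.sum_le_sum fun k hk => (hπ k hk).2

theorem TransportLE.trans {d : α → α → ℝ} (hd : ∀ a b c, d a c ≤ d a b + d b c)
    {μ ν ρ : α → ℝ} {c c' : ℝ}
    (h : TransportLE d μ ν c) (h' : TransportLE d ν ρ c') : TransportLE d μ ρ (c + c') := by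
  obtain ⟨π, ⟨h0, h1, h2⟩, hcost⟩ := h
  obtain ⟨π', ⟨h0', h1', h2'⟩, hcost'⟩ := h'
  have hν : ∀ b, 0 ≤ ν b := fun b => h2 b ▸ Finset.sum_nonneg fun a _ => h0 _
  have left (a b : α) : ∑ c, π (a, b) * π' (b, c) / ν b = π (a, b) := by
    rw [← Finset.sum_div, ← Finset.mul_sum, h1']
    rcases eq_or_ne (ν b) 0 with hb | hb
    · have : π (a, b) = 0 :=
        (Finset.sum_eq_zero_iff_of_nonneg fun a _ => h0 (a, b)).1 ((h2 b).trans hb) a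
          (Finset.mem_univ a)
      simp [this]
    · field_simp
  have right (b c : α) : ∑ a, π (a, b) * π' (b, c) / ν b = π' (b, c) := by
    rw [← Finset.sum_div, ← Finset.sum_mul, h2]
    rcases eq_or_ne (ν b) 0 with hb | hb
    · have : π' (b, c) = 0 :=
        (Finset.sum_eq_zero_iff_of_nonneg fun c _ => h0' (b, c)).1 ((h1' b).trans hb) c
          (Finset.mem_univ c)
      simp [this]
    · field_simp
  have nonneg (a b c : α) : 0 ≤ π (a, b) * π' (b, c) / ν b :=
    div_nonneg (mul_nonneg (h0 _) (h0' _)) (hν b)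
  refine ⟨fun q => ∑ b, π (q.1, b) * π' (b, q.2) / ν b,
    ⟨fun q => Finset.sum_nonneg fun b _ => nonneg _ _ _, fun a => ?_, fun c => ?_⟩, ?_⟩
  · rw [Finset.sum_comm]
    simp only [left, h1]
  · rw [Finset.sum_comm]
    simp only [right, h2']
  · rw [Fintype.sum_prod_type] at hcost hcost' ⊢
    calc ∑ a, ∑ c, (∑ b, π (a, b) * π' (b, c) / ν b) * d a c
        ≤ ∑ a, ∑ c, ∑ b, (π (a, b) * π' (b, c) / ν b * d a b +
            π (a, b) * π' (b, c) / ν b * d b c) := by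
          refine Finset.sum_le_sum fun a _ => Finset.sum_le_sum fun c _ => ?_
          rw [Finset.sum_mul]
          refine Finset.sum_le_sum fun b _ => ?_
          rw [← mul_add]
          exact mul_le_mul_of_nonneg_left (hd a b c) (nonneg a b c)
      _ = ∑ a, ∑ b, π (a, b) * d a b + ∑ b, ∑ c, π' (b, c) * d b c := by
          simp only [Finset.sum_add_distrib]
          congr 1
          · refine Finset.sum_congr rfl fun a _ => ?_
            rw [Finset.sum_comm]
            simp only [← Finset.sum_mul, left]
          · rw [Finset.sum_comm, Finset.sum_comm (f := fun b c => π' (b, c) * d b c)]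
            refine Finset.sum_congr rfl fun c _ => ?_
            rw [Finset.sum_comm]
            simp only [← Finset.sum_mul, right]
      _ ≤ c + c' := add_le_add hcost hcost'

theorem transportLE_push {d : α → α → ℝ} {μ : α → ℝ} (hμ : ∀ a, 0 ≤ μ a) (f : α → α) {r : ℝ}
    (hd : ∀ a, d a (f a) ≤ r) : TransportLE d μ (push f μ) ((∑ a, μ a) * r) := by
  refine ⟨fun q => if f q.1 = q.2 then μ q.1 else 0,
    ⟨fun q => ?_, fun a => ?_, fun b => rfl⟩, ?_⟩
  · dsimp only
    split_ifs
    exacts [hμ _, le_rfl]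
  · simp
  · rw [Fintype.sum_prod_type, Finset.sum_mul]
    refine Finset.sum_le_sum fun a _ => ?_
    simpa [ite_mul] using mul_le_mul_of_nonneg_left (hd a) (hμ a)

theorem transportLE_refl {d : α → α → ℝ} {μ : α → ℝ} (hμ : ∀ a, 0 ≤ μ a) (hd : ∀ a, d a a = 0) :
    TransportLE d μ μ 0 := by
  have h := transportLE_push hμ id (d := d) (r := 0) fun a => (hd a).le
  have hid : push id μ = μ := by
    funext b
    simp [push]
  rwa [hid, mul_zero] at h

theorem sum_push (f : α → α) (μ : α → ℝ) : ∑ b, push f μ b = ∑ a, μ a := by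
  unfold push
  rw [Finset.sum_comm]
  simp

theorem push_smul (f : α → α) (t : ℝ) (μ : α → ℝ) :
    push f (fun a => t * μ a) = fun b => t * push f μ b := by
  funext b
  simp [push, Finset.mul_sum]

end Transport

section Distance

variable {V : Type*} [DecidableEq V]

theorem edist_self (M : Finset (Sym2 V)) : edist M M = 0 := by
  simp [edist]

theorem edist_comm (M N : Finset (Sym2 V)) : edist M N = edist N M := by
  rw [edist, edist, Finset.union_comm]

theorem edist_triangle (L M N : Finset (Sym2 V)) : edist L N ≤ edist L M + edist M N := by
  refine le_trans (Finset.card_le_card ?_) (Finset.card_union_le _ _)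
  intro e
  simp only [Finset.mem_union, Finset.mem_sdiff]
  tauto

theorem edist_insert_le (e : Sym2 V) (M : Finset (Sym2 V)) : edist M (insert e M) ≤ 1 := by
  rw [← Finset.card_singleton e]
  refine Finset.card_le_card ?_
  intro f
  simp only [Finset.mem_union, Finset.mem_sdiff, Finset.mem_insert, Finset.mem_singleton]
  tauto

end Distance

section Weights

variable {V : Type*}

/-- `M` is a matching of `G` covering no vertex of `S`. -/
def IsMatchingAvoiding (G : SimpleGraph V) (S : Finset V) (M : Finset (Sym2 V)) : Prop :=
  IsMatchingSet G M ∧ ∀ e ∈ M, ∀ v ∈ S, v ∉ e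

/-- The weight of `M` in the monomer-dimer model on `G` with the vertices of `S` removed. -/
noncomputable def weight (G : SimpleGraph V) (lam : ℝ) (S : Finset V) (M : Finset (Sym2 V)) : ℝ :=
  if IsMatchingAvoiding G S M then lam ^ M.card else 0

variable {G : SimpleGraph V} {lam : ℝ}

theorem weight_nonneg (hlam : 0 < lam) (S : Finset V) (M : Finset (Sym2 V)) :
    0 ≤ weight G lam S M := by
  unfold weight
  split_ifs <;> positivity

theorem isMatchingAvoiding_insert_edge [DecidableEq V] {S : Finset V} {u w : V} (hadj : G.Adj u w)
    (hu : u ∉ S) (hw : w ∉ S) {N : Finset (Sym2 V)} (hN : s(u, w) ∉ N) :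
    IsMatchingAvoiding G S (insert s(u, w) N) ↔ IsMatchingAvoiding G (insert w (insert u S)) N := by
  constructor
  · rintro ⟨⟨h1, h2⟩, h3⟩
    refine ⟨⟨fun e he => h1 e (Finset.mem_insert_of_mem he), fun e he f hf =>
      h2 e (Finset.mem_insert_of_mem he) f (Finset.mem_insert_of_mem hf)⟩, fun e he v hv => ?_⟩
    have hne : s(u, w) ≠ e := fun h => hN (h ▸ he)
    have key := h2 s(u, w) (Finset.mem_insert_self _ _) e (Finset.mem_insert_of_mem he) hne
    rcases Finset.mem_insert.1 hv with rfl | hv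
    · exact key _ (Sym2.mem_mk_right _ _)
    rcases Finset.mem_insert.1 hv with rfl | hv
    · exact key _ (Sym2.mem_mk_left _ _)
    · exact h3 e (Finset.mem_insert_of_mem he) v hv
  · rintro ⟨⟨h1, h2⟩, h3⟩
    have key : ∀ e ∈ N, ∀ v, v ∈ s(u, w) → v ∉ e := by
      intro e he v hv
      rcases Sym2.mem_iff.1 hv with rfl | rfl
      · exact h3 e he _ (by simp)
      · exact h3 e he _ (by simp)
    refine ⟨⟨fun e he => ?_, fun e he f hf hef v hve => ?_⟩, fun e he v hv => ?_⟩
    · rcases Finset.mem_insert.1 he with rfl | he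
      exacts [hadj, h1 e he]
    · rcases Finset.mem_insert.1 he with rfl | he <;> rcases Finset.mem_insert.1 hf with rfl | hf
      · exact absurd rfl hef
      · exact key f hf v hve
      · exact fun hvf => key e he v hvf hve
      · exact h2 e he f hf hef v hve
    · rcases Finset.mem_insert.1 he with rfl | he
      · intro hv'
        rcases Sym2.mem_iff.1 hv' with rfl | rfl
        exacts [hu hv, hw hv]
      · exact h3 e he v (by simp [hv])

theorem isMatchingSet_deleteEdges_iff (i : Sym2 V) (M : Finset (Sym2 V)) :
    IsMatchingSet (G.deleteEdges {i}) M ↔ IsMatchingSet G M ∧ i ∉ M := by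
  simp only [IsMatchingSet, SimpleGraph.edgeSet_deleteEdges, Set.mem_sdiff, Set.mem_singleton_iff]
  constructor
  · rintro ⟨h1, h2⟩
    exact ⟨⟨fun e he => (h1 e he).1, h2⟩, fun h => (h1 i h).2 rfl⟩
  · rintro ⟨⟨h1, h2⟩, h3⟩
    exact ⟨fun e he => ⟨h1 e he, fun h => h3 (h ▸ he)⟩, h2⟩

theorem weight_deleteEdges {u v : V} {S : Finset V} (hu : u ∈ S) :
    weight (G.deleteEdges {s(u, v)}) lam S = weight G lam S := by
  funext M
  have : IsMatchingAvoiding (G.deleteEdges {s(u, v)}) S M ↔ IsMatchingAvoiding G S M := by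
    simp only [IsMatchingAvoiding, isMatchingSet_deleteEdges_iff]
    exact ⟨fun h => ⟨h.1.1, h.2⟩,
      fun h => ⟨⟨h.1, fun hm => h.2 _ hm u hu (Sym2.mem_mk_left _ _)⟩, h.2⟩⟩
  simp only [weight, this]

variable [Fintype V]

/-- The partition function of `G` with the vertices of `S` removed. -/
noncomputable def totalWeight (G : SimpleGraph V) (lam : ℝ) (S : Finset V) : ℝ :=
  ∑ M, weight G lam S M

/-- The Gibbs distribution on `G` with the vertices of `S` removed. -/
noncomputable def gibbsAvoiding (G : SimpleGraph V) (lam : ℝ) (S : Finset V)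
    (M : Finset (Sym2 V)) : ℝ :=
  (totalWeight G lam S)⁻¹ * weight G lam S M

theorem totalWeight_pos (hlam : 0 < lam) (S : Finset V) : 0 < totalWeight G lam S := by
  refine Finset.sum_pos' (fun M _ => weight_nonneg hlam S M) ⟨∅, Finset.mem_univ _, ?_⟩
  simp [weight, IsMatchingAvoiding, IsMatchingSet]

theorem gibbsAvoiding_nonneg (hlam : 0 < lam) (S : Finset V) (M : Finset (Sym2 V)) :
    0 ≤ gibbsAvoiding G lam S M :=
  mul_nonneg (inv_nonneg.2 (totalWeight_pos hlam S).le) (weight_nonneg hlam S M)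

theorem sum_gibbsAvoiding (hlam : 0 < lam) (S : Finset V) :
    ∑ M, gibbsAvoiding G lam S M = 1 := by
  simp only [gibbsAvoiding, ← Finset.mul_sum]
  exact inv_mul_cancel₀ (totalWeight_pos hlam S).ne'

theorem totalWeight_mul_gibbsAvoiding (hlam : 0 < lam) (S : Finset V) (M : Finset (Sym2 V)) :
    totalWeight G lam S * gibbsAvoiding G lam S M = weight G lam S M := by
  rw [gibbsAvoiding, mul_inv_cancel_left₀ (totalWeight_pos hlam S).ne']

theorem totalWeight_anti (hlam : 0 < lam) {S T : Finset V} (h : S ⊆ T) :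
    totalWeight G lam T ≤ totalWeight G lam S := by
  refine Finset.sum_le_sum fun M _ => ?_
  unfold weight
  split_ifs with h1 h2 h2
  · exact le_rfl
  · exact absurd ⟨h1.1, fun e he v hv => h1.2 e he v (h hv)⟩ h2
  · positivity
  · exact le_rfl

variable [DecidableEq V]

theorem push_insert_weight {S : Finset V} {u w : V} (hadj : G.Adj u w)
    (hu : u ∉ S) (hw : w ∉ S) (M : Finset (Sym2 V)) :
    lam * push (insert s(u, w)) (weight G lam (insert w (insert u S))) M =
      if s(u, w) ∈ M then weight G lam S M else 0 := by
  split_ifs with hM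
  · have hN : s(u, w) ∉ M.erase s(u, w) := Finset.notMem_erase _ _
    have hins : insert s(u, w) (M.erase s(u, w)) = M := Finset.insert_erase hM
    have hcard : (M.erase s(u, w)).card + 1 = M.card := Finset.card_erase_add_one hM
    unfold push
    rw [Finset.sum_eq_single (M.erase s(u, w))]
    · rw [if_pos hins, weight, weight, ← isMatchingAvoiding_insert_edge hadj hu hw hN, hins,
        ← hcard, pow_succ']
      split_ifs <;> simp
    · intro N _ hne
      split_ifs with h
      · refine if_neg fun hav => hne ?_
        rw [← h, Finset.erase_insert]
        exact fun hmem => hav.2 _ hmem u (by simp) (Sym2.mem_mk_left _ _)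
      · rfl
    · simp
  · unfold push
    rw [Finset.sum_eq_zero, mul_zero]
    intro N _
    refine if_neg fun h => hM ?_
    exact h ▸ Finset.mem_insert_self _ _

theorem weight_eq_add_sum {S : Finset V} {u : V} (hu : u ∉ S) (M : Finset (Sym2 V)) :
    weight G lam S M = weight G lam (insert u S) M +
      ∑ w with G.Adj u w ∧ w ∉ S,
        lam * push (insert s(u, w)) (weight G lam (insert w (insert u S))) M := by
  rw [Finset.sum_congr rfl fun w hw =>
    push_insert_weight (Finset.mem_filter.1 hw).2.1 hu (Finset.mem_filter.1 hw).2.2 M]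
  by_cases hM : IsMatchingAvoiding G S M
  swap
  · have : ¬ IsMatchingAvoiding G (insert u S) M := fun h =>
      hM ⟨h.1, fun e he v hv => h.2 e he v (Finset.mem_insert_of_mem hv)⟩
    simp [weight, hM, this]
  by_cases hcov : ∃ e ∈ M, u ∈ e
  · obtain ⟨e, he, hue⟩ := hcov
    obtain ⟨w, rfl⟩ := hue
    have hnot : ¬ IsMatchingAvoiding G (insert u S) M := fun h =>
      h.2 _ he u (Finset.mem_insert_self _ _) (Sym2.mem_mk_left _ _)
    rw [Finset.sum_eq_single w]
    · simp [weight, hnot, he]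
    · intro w' _ hne
      refine if_neg fun he' => ?_
      exact hM.1.2 _ he' _ he (fun h => hne (Sym2.congr_right.1 h)) u (Sym2.mem_mk_left _ _)
        (Sym2.mem_mk_left _ _)
    · intro hw
      refine absurd ?_ hw
      simp only [Finset.mem_filter, Finset.mem_univ, true_and]
      exact ⟨hM.1.1 _ he, fun h => hM.2 _ he w h (Sym2.mem_mk_right _ _)⟩
  · have hyes : IsMatchingAvoiding G (insert u S) M := by
      refine ⟨hM.1, fun e he v hv => ?_⟩
      rcases Finset.mem_insert.1 hv with rfl | hv
      · exact fun h => hcov ⟨e, he, h⟩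
      · exact hM.2 e he v hv
    rw [Finset.sum_eq_zero fun w _ => if_neg fun h => hcov ⟨_, h, Sym2.mem_mk_left _ _⟩]
    simp [weight, hM, hyes]

theorem totalWeight_eq_add_sum {S : Finset V} {u : V} (hu : u ∉ S) :
    totalWeight G lam S = totalWeight G lam (insert u S) +
      ∑ w with G.Adj u w ∧ w ∉ S, lam * totalWeight G lam (insert w (insert u S)) := by
  conv_lhs => rw [totalWeight, Finset.sum_congr rfl fun M _ => weight_eq_add_sum hu M]
  rw [Finset.sum_add_distrib, Finset.sum_comm]
  simp only [← Finset.mul_sum, sum_push]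
  rfl

/-- Removing one vertex moves the Gibbs distribution by at most `lam * Δ` in Wasserstein
distance. -/
theorem transportLE_insert_vertex (hlam : 0 < lam) {Δ : ℕ} (hdeg : ∀ v, degr G v ≤ Δ)
    (S : Finset V) {u : V} (hu : u ∉ S) :
    TransportLE (fun M N => (edist M N : ℝ)) (gibbsAvoiding G lam (insert u S))
      (gibbsAvoiding G lam S) (lam * Δ) := by
  have hsymm (M N : Finset (Sym2 V)) : (edist M N : ℝ) = edist N M := by rw [edist_comm]
  have htri (L M N : Finset (Sym2 V)) : (edist L N : ℝ) ≤ edist L M + edist M N := by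
    exact_mod_cast edist_triangle L M N
  induction hn : Sᶜ.card using Nat.strong_induction_on generalizing S u with
  | _ n ih =>
  set W : Finset V := Finset.univ.filter fun w => G.Adj u w ∧ w ∉ S with hW
  set Z := totalWeight G lam S
  set Z₀ := totalWeight G lam (insert u S)
  set Y : V → ℝ := fun w => lam * totalWeight G lam (insert w (insert u S)) with hY
  have hZpos : 0 < Z := totalWeight_pos hlam S
  have hYpos (w : V) : 0 < Y w := mul_pos hlam (totalWeight_pos hlam _)
  have hsum : Z = Z₀ + ∑ w ∈ W, Y w := totalWeight_eq_add_sum hu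
  have hbound : ∑ w ∈ W, Y w ≤ lam * Δ * Z₀ := by
    calc ∑ w ∈ W, Y w ≤ ∑ w ∈ W, lam * Z₀ := Finset.sum_le_sum fun w _ =>
          mul_le_mul_of_nonneg_left (totalWeight_anti hlam (Finset.subset_insert _ _)) hlam.le
      _ = lam * W.card * Z₀ := by rw [Finset.sum_const, nsmul_eq_mul]; ring
      _ ≤ lam * Δ * Z₀ := by
          have : W.card ≤ Δ := le_trans (Finset.card_le_card fun w hw => by
            simp only [hW, Finset.mem_filter, Finset.mem_univ, true_and] at hw ⊢
            exact hw.1) (hdeg u)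
          have := totalWeight_pos (G := G) hlam (insert u S)
          gcongr
  have hstep : ∀ w ∈ W, TransportLE (fun M N => (edist M N : ℝ)) (gibbsAvoiding G lam (insert u S))
      (push (insert s(u, w)) (gibbsAvoiding G lam (insert w (insert u S)))) (lam * Δ + 1) := by
    intro w hw
    obtain ⟨hadj, hwS⟩ := (Finset.mem_filter.1 hw).2
    have hw' : w ∉ insert u S := by
      simp [hwS, hadj.ne']
    have hlt : (insert u S)ᶜ.card < n := by
      rw [← hn]
      exact Finset.card_lt_card (Finset.compl_ssubset_compl.2 (Finset.ssubset_insert hu))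
    refine ((ih _ hlt (insert u S) hw' rfl).symm hsymm).trans htri ?_
    have := transportLE_push (d := fun M N => (edist M N : ℝ))
      (gibbsAvoiding_nonneg (G := G) hlam (insert w (insert u S))) (insert s(u, w)) (r := 1)
      fun M => by exact_mod_cast edist_insert_le s(u, w) M
    rwa [sum_gibbsAvoiding hlam, one_mul] at this
  have hmix := ((transportLE_refl (d := fun M N => (edist M N : ℝ))
      (gibbsAvoiding_nonneg (G := G) hlam (insert u S)) fun M => by simp [edist_self]).smul
        (totalWeight_pos (G := G) hlam (insert u S)).le).add
    (TransportLE.sum W fun w hw => (hstep w hw).smul (hYpos w).le)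
  have hscaled := hmix.smul (inv_nonneg.2 hZpos.le)
  have hcost : Z⁻¹ * (Z₀ * 0 + ∑ w ∈ W, Y w * (lam * Δ + 1)) ≤ lam * Δ := by
    rw [inv_mul_le_iff₀ hZpos, ← Finset.sum_mul, hsum]
    linarith
  convert hscaled.mono hcost using 1
  · funext M
    rw [← Finset.sum_mul, ← add_mul, ← hsum, inv_mul_cancel_left₀ hZpos.ne']
  · funext M
    rw [gibbsAvoiding, weight_eq_add_sum hu, totalWeight_mul_gibbsAvoiding hlam]
    congr 2
    refine Finset.sum_congr rfl fun w _ => ?_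
    have hweight : weight G lam (insert w (insert u S)) = fun N =>
        totalWeight G lam (insert w (insert u S)) * gibbsAvoiding G lam (insert w (insert u S)) N :=
      funext fun N => (totalWeight_mul_gibbsAvoiding hlam _ N).symm
    rw [hweight, push_smul, hY, mul_assoc]

theorem condDist_eq_normalize {p : Finset (Sym2 V) → Prop} {w : Finset (Sym2 V) → ℝ}
    (hw : ∀ M, IsMatchingSet G M ∧ p M → w M = lam ^ M.card)
    (hw₀ : ∀ M, ¬(IsMatchingSet G M ∧ p M) → w M = 0) :
    condDist G lam p = fun M => (∑ N, w N)⁻¹ * w M := by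
  funext M
  rw [condDist, condDistMap, div_eq_inv_mul, matchings, Finset.filter_filter]
  congr 2
  · rw [Finset.sum_filter]
    refine Finset.sum_congr rfl fun N _ => ?_
    split_ifs with h
    exacts [(hw N h).symm, (hw₀ N h).symm]
  · rw [Finset.sum_filter]
    by_cases h : IsMatchingSet G M ∧ p M
    · simp [h, hw M h]
    · simp [h, hw₀ M h]

theorem condDist_notMem (i : Sym2 V) :
    condDist G lam (fun M => i ∉ M) = gibbsAvoiding (G.deleteEdges {i}) lam ∅ := by
  refine condDist_eq_normalize (fun M h => ?_) fun M h => ?_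
  · simp [weight, IsMatchingAvoiding, isMatchingSet_deleteEdges_iff, h]
  · simp [weight, IsMatchingAvoiding, isMatchingSet_deleteEdges_iff, h]

theorem condDist_mem (hlam : 0 < lam) {u v : V} (hadj : G.Adj u v) :
    condDist G lam (fun M => s(u, v) ∈ M) = push (insert s(u, v))
      (gibbsAvoiding (G.deleteEdges {s(u, v)}) lam {v, u}) := by
  have hweight (M : Finset (Sym2 V)) : lam * push (insert s(u, v)) (weight G lam {v, u}) M =
      if s(u, v) ∈ M then weight G lam ∅ M else 0 := by
    simpa using
      push_insert_weight (lam := lam) hadj (Finset.notMem_empty u) (Finset.notMem_empty v) M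
  rw [condDist_eq_normalize
    (w := fun M => lam * push (insert s(u, v)) (weight G lam {v, u}) M)]
  · have hgibbs : gibbsAvoiding (G.deleteEdges {s(u, v)}) lam {v, u} =
        fun M => (∑ N, weight G lam {v, u} N)⁻¹ * weight G lam {v, u} M := by
      funext M
      rw [gibbsAvoiding, totalWeight, weight_deleteEdges (by simp)]
    funext M
    rw [hgibbs, push_smul, ← Finset.mul_sum, sum_push, mul_inv]
    field_simp
  · rintro M ⟨h, hM⟩
    rw [hweight, if_pos hM]
    simp [weight, IsMatchingAvoiding, h]
  · intro M h
    rw [hweight]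
    split_ifs with hM
    · exact if_neg fun h' => h ⟨h'.1, hM⟩
    · rfl

end Weights

/-- there is a coupling of `μ_{G,λ}(· | i ∈ M)` and `μ_{G,λ}(· | i ∉ M)`
with expected edge-Hamming distance at most `1 + 2λΔ`. -/
theorem stmt_8 {V : Type*} [Fintype V] [DecidableEq V]
    (G : SimpleGraph V) (Δ : ℕ) (hΔ : 1 ≤ Δ) (hdeg : ∀ v : V, degr G v ≤ Δ)
    (i : Sym2 V) (hi : i ∈ G.edgeSet) (lam : ℝ) (hlam : 0 < lam) :
    ∃ π : Finset (Sym2 V) × Finset (Sym2 V) → ℝ,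
      IsCoupling π (condDist G lam (fun M => i ∈ M)) (condDist G lam (fun M => i ∉ M)) ∧
      ∑ q : Finset (Sym2 V) × Finset (Sym2 V), π q * (edist q.1 q.2 : ℝ) ≤
        1 + 2 * lam * (Δ : ℝ) := by
  induction i using Sym2.ind with
  | _ u v =>
  have hadj : G.Adj u v := hi
  have hdeg' (w : V) : degr (G.deleteEdges {s(u, v)}) w ≤ Δ := by
    refine le_trans (Finset.card_le_card fun x hx => ?_) (hdeg w)
    simp only [Finset.mem_filter, Finset.mem_univ, true_and] at hx ⊢
    exact SimpleGraph.deleteEdges_le _ hx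
  have hvu : v ∉ ({u} : Finset V) := by simpa using hadj.ne'
  have hsymm (M N : Finset (Sym2 V)) : (edist M N : ℝ) = edist N M := by rw [edist_comm]
  have htri (L M N : Finset (Sym2 V)) : (edist L N : ℝ) ≤ edist L M + edist M N := by
    exact_mod_cast edist_triangle L M N
  have hpush := (transportLE_push (d := fun M N => (edist M N : ℝ))
    (gibbsAvoiding_nonneg (G := G.deleteEdges {s(u, v)}) hlam {v, u}) (insert s(u, v)) (r := 1)
    fun M => by exact_mod_cast edist_insert_le s(u, v) M).symm hsymm
  rw [sum_gibbsAvoiding hlam, one_mul] at hpush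
  have hv := transportLE_insert_vertex hlam hdeg' {u} hvu
  have hu := transportLE_insert_vertex hlam hdeg' ∅ (Finset.notMem_empty u)
  rw [insert_empty_eq] at hu
  rw [condDist_mem hlam hadj, condDist_notMem]
  exact ((hpush.trans htri hv).trans htri hu).mono (by linarith)

end SensMatching
end
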